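/- arXiv:2501.06763 — 2 statements merged into one kernel-verified Lean document; each statement's English description precedes it below -/
import Mathlib

section
/- For positive integers n and m, the sum over all m-multipartitions λ of n of the square of the number of standard tableaux of shape λ equals n! · mⁿ. -/
/-- A multipartition-like shape: `comps` components, each either strict
(shifted diagram) or an ordinary partition diagram.  A box is a triple
`(l, i, j)`: component `l`, row `i`, column `j` (all 0-indexed). -/
structure MultiShape where
  comps : ℕ
  isStrict : ℕ → Bool
  part : ℕ → ℕ → ℕ

namespace MultiShape

/-- The set of boxes of the diagram of the shape.  In a strict component the
`i`-th row is shifted `i` steps to the right. -/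
def cells (Λ : MultiShape) : Set (ℕ × ℕ × ℕ) :=
  {b | b.1 < Λ.comps ∧
    (if Λ.isStrict b.1 then
        b.2.1 ≤ b.2.2 ∧ b.2.2 < b.2.1 + Λ.part b.1 b.2.1
      else b.2.2 < Λ.part b.1 b.2.1)}

/-- `p : ℕ → ℕ` is a strict partition: weakly decreasing and strictly
decreasing on nonzero parts. -/
def IsStrictPartFun (p : ℕ → ℕ) : Prop :=
  Antitone p ∧ ∀ i, p (i + 1) ≠ 0 → p (i + 1) < p i

/-- Well-formedness of a shape: strict components are strict partitions,
ordinary components are partitions, and everything beyond `comps` is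
normalized to zero. -/
def WellFormed (Λ : MultiShape) : Prop :=
  (∀ l < Λ.comps, Λ.isStrict l = true → IsStrictPartFun (Λ.part l)) ∧
  (∀ l < Λ.comps, Λ.isStrict l = false → Antitone (Λ.part l)) ∧
  (∀ l, Λ.comps ≤ l → (Λ.part l = fun _ => 0) ∧ Λ.isStrict l = false)

/-- `t` is a standard tableau of shape `Λ` with entries `1,…,n`: a bijection
from the boxes onto `{1,…,n}`, increasing along rows and columns of each
component, normalized to `0` outside the diagram. -/
def IsStd (Λ : MultiShape) (n : ℕ) (t : ℕ × ℕ × ℕ → ℕ) : Prop :=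
  Set.BijOn t Λ.cells (Set.Icc 1 n) ∧
  (∀ b ∈ Λ.cells, ∀ b' ∈ Λ.cells,
      b.1 = b'.1 → b.2.1 = b'.2.1 → b.2.2 < b'.2.2 → t b < t b') ∧
  (∀ b ∈ Λ.cells, ∀ b' ∈ Λ.cells,
      b.1 = b'.1 → b.2.2 = b'.2.2 → b.2.1 < b'.2.1 → t b < t b') ∧
  (∀ b, b ∉ Λ.cells → t b = 0)

/-- The simple transposition `s_k = (k, k+1)` acting on entries. -/
def sw (k : ℕ) : Equiv.Perm ℕ := Equiv.swap k (k + 1)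

/-- The permutation `s_{i_k} ⋯ s_{i_1}` associated to the word `w = [i_1,…,i_k]`
(the first letter acts first). -/
def wordPerm (w : List ℕ) : Equiv.Perm ℕ :=
  w.foldl (fun σ k => sw k * σ) 1

end MultiShape

namespace MultiShape

/-- `Λ` is (the normalized encoding of) an ordinary `m`-multipartition. -/
def IsOrdinaryMulti (Λ : MultiShape) (m : ℕ) : Prop :=
  Λ.comps = m ∧ Λ.isStrict = (fun _ => false) ∧ Λ.WellFormed

end MultiShape

namespace RSProof

abbrev Cell := ℕ × ℕ × ℕ

/-- finite multi-diagrams with `m` components -/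
def Low (m : ℕ) (S : Finset Cell) : Prop :=
  ∀ l i j, (l, i, j) ∈ S → l < m ∧ ∀ i' ≤ i, ∀ j' ≤ j, (l, i', j') ∈ S

theorem low_union {m : ℕ} {S T : Finset Cell} (hS : Low m S) (hT : Low m T) :
    Low m (S ∪ T) := by
  intro l i j h
  rcases Finset.mem_union.1 h with h | h
  · exact ⟨(hS l i j h).1, fun i' hi j' hj => Finset.mem_union_left _ ((hS l i j h).2 i' hi j' hj)⟩
  · exact ⟨(hT l i j h).1, fun i' hi j' hj => Finset.mem_union_right _ ((hT l i j h).2 i' hi j' hj)⟩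

theorem low_inter {m : ℕ} {S T : Finset Cell} (hS : Low m S) (hT : Low m T) :
    Low m (S ∩ T) := by
  intro l i j h
  rw [Finset.mem_inter] at h
  exact ⟨(hS l i j h.1).1, fun i' hi j' hj => Finset.mem_inter.2
    ⟨(hS l i j h.1).2 i' hi j' hj, (hT l i j h.2).2 i' hi j' hj⟩⟩

theorem low_bound {m : ℕ} {S : Finset Cell} (hS : Low m S) {l i j : ℕ} (h : (l, i, j) ∈ S) :
    l < m ∧ i < S.card ∧ j < S.card := by
  refine ⟨(hS l i j h).1, ?_, ?_⟩
  · have : (Finset.range (i+1)).image (fun k => ((l, k, j) : Cell)) ⊆ S := by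
      intro x hx
      obtain ⟨k, hk, rfl⟩ := Finset.mem_image.1 hx
      exact (hS l i j h).2 k (by simpa [Nat.lt_succ_iff] using hk) j le_rfl
    have h2 := Finset.card_le_card this
    rw [Finset.card_image_of_injective _ (by intro a b hab; simpa using hab)] at h2
    simpa using h2
  · have : (Finset.range (j+1)).image (fun k => ((l, i, k) : Cell)) ⊆ S := by
      intro x hx
      obtain ⟨k, hk, rfl⟩ := Finset.mem_image.1 hx
      exact (hS l i j h).2 i le_rfl k (by simpa [Nat.lt_succ_iff] using hk)
    have h2 := Finset.card_le_card this
    rw [Finset.card_image_of_injective _ (by intro a b hab; simpa using hab)] at h2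
    simpa using h2

open Classical in
noncomputable def rem (m : ℕ) (S : Finset Cell) : Finset Cell :=
  S.filter (fun b => Low m (S.erase b))

open Classical in
noncomputable def addable (m : ℕ) (S : Finset Cell) : Finset Cell :=
  (Finset.range m ×ˢ (Finset.range (S.card + 1) ×ˢ Finset.range (S.card + 1))).filter
    (fun a => a ∉ S ∧ Low m (insert a S))

open Classical in
noncomputable def lev (m n : ℕ) : Finset (Finset Cell) :=
  (Finset.range m ×ˢ (Finset.range n ×ˢ Finset.range n)).powerset.filter
    (fun S => Low m S ∧ S.card = n)

theorem mem_rem {m : ℕ} {S : Finset Cell} {b : Cell} :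
    b ∈ rem m S ↔ b ∈ S ∧ Low m (S.erase b) := by
  simp [rem]

theorem mem_add {m : ℕ} {S : Finset Cell} {a : Cell} :
    a ∈ addable m S ↔ a ∉ S ∧ Low m (insert a S) := by
  classical
  unfold addable
  rw [Finset.mem_filter]
  refine ⟨fun h => h.2, fun h => ⟨?_, h⟩⟩
  obtain ⟨l, i, j⟩ := a
  have := low_bound h.2 (Finset.mem_insert_self _ _)
  rw [Finset.card_insert_of_notMem h.1] at this
  simpa using this

theorem mem_lev {m n : ℕ} {S : Finset Cell} :
    S ∈ lev m n ↔ Low m S ∧ S.card = n := by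
  classical
  unfold lev
  rw [Finset.mem_filter]
  refine ⟨fun h => h.2, fun h => ⟨?_, h⟩⟩
  rw [Finset.mem_powerset]
  rintro ⟨l, i, j⟩ hx
  have := low_bound h.1 hx
  rw [h.2] at this
  simpa using this

theorem exists_rows {m : ℕ} {S : Finset Cell} (hS : Low m S) :
    ∃ p : ℕ → ℕ → ℕ, (∀ l i j, (l, i, j) ∈ S ↔ j < p l i) ∧ (∀ l, Antitone (p l)) ∧
      (∀ l, m ≤ l → ∀ i, p l i = 0) := by
  classical
  have ex : ∀ l i, ∃ j, (l, i, j) ∉ S := fun l i =>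
    ⟨S.card, fun h => lt_irrefl _ (low_bound hS h).2.2⟩
  have key : ∀ l i j, (l, i, j) ∈ S ↔ j < Nat.find (ex l i) := by
    intro l i j
    rw [Nat.lt_find_iff]
    constructor
    · intro h k hk
      exact not_not.2 ((hS l i j h).2 i le_rfl k hk)
    · intro h
      exact not_not.1 (h j le_rfl)
  refine ⟨fun l i => Nat.find (ex l i), key, ?_, ?_⟩
  · intro l i i' hi
    by_contra hlt
    have h1 := (key l i' (Nat.find (ex l i))).2 (not_le.1 hlt)
    have h2 := (hS _ _ _ h1).2 i hi _ le_rfl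
    exact lt_irrefl _ ((key l i _).1 h2)
  · intro l hl i
    by_contra hne
    have h1 := (key l i 0).2 (Nat.pos_of_ne_zero hne)
    exact absurd (hS _ _ _ h1).1 (by omega)

theorem card_add {m : ℕ} {S : Finset Cell} (hS : Low m S) :
    (addable m S).card = (rem m S).card + m := by
  obtain ⟨p, hp, anti, hz⟩ := exists_rows hS
  have hrem : ∀ l i j, (l, i, j) ∈ rem m S ↔ j + 1 = p l i ∧ p l (i+1) ≤ j := by
    intro l i j
    rw [mem_rem]
    constructor
    · rintro ⟨h1, h2⟩
      have a1 := (hp l i j).1 h1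
      constructor
      · by_contra hne
        have : (l, i, j+1) ∈ S.erase (l, i, j) := by
          rw [Finset.mem_erase, hp]; exact ⟨by simp, by omega⟩
        exact absurd ((h2 _ _ _ this).2 i le_rfl j (by omega)) (by simp)
      · by_contra hne
        have : (l, i+1, j) ∈ S.erase (l, i, j) := by
          rw [Finset.mem_erase, hp]; exact ⟨by simp, by omega⟩
        exact absurd ((h2 _ _ _ this).2 i (by omega) j le_rfl) (by simp)
    · rintro ⟨h1, h2⟩
      refine ⟨(hp _ _ _).2 (by omega), ?_⟩
      intro l' i' j' h
      rw [Finset.mem_erase] at h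
      refine ⟨(hS _ _ _ h.2).1, fun i₂ hi j₂ hj => ?_⟩
      rw [Finset.mem_erase]
      refine ⟨?_, (hS _ _ _ h.2).2 _ hi _ hj⟩
      intro e
      simp only [Prod.mk.injEq] at e
      obtain ⟨rfl, rfl, rfl⟩ := e
      have h3 := (hp _ _ _).1 h.2
      rcases Nat.eq_or_lt_of_le hi with e | e
      · subst e
        apply h.1
        have : j' = j₂ := by omega
        rw [this]
      · have := anti l' (show i₂ + 1 ≤ i' from e)
        omega
  have hadd : ∀ l i j, (l, i, j) ∈ addable m S ↔
      l < m ∧ j = p l i ∧ (∀ k, i = k + 1 → p l i < p l k) := by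
    intro l i j
    rw [mem_add]
    constructor
    · rintro ⟨h1, h2⟩
      rw [hp] at h1
      have h3 := h2 l i j (Finset.mem_insert_self _ _)
      have h4 : j = p l i := by
        by_contra hne
        have := h3.2 i le_rfl (j-1) (by omega)
        rw [Finset.mem_insert, hp] at this
        rcases this with h | h
        · simp at h; omega
        · omega
      refine ⟨h3.1, h4, ?_⟩
      rintro k rfl
      have := h3.2 k (by omega) j le_rfl
      rw [Finset.mem_insert, hp] at this
      rcases this with h | h
      · simp at h
      · omega
    · rintro ⟨hl, rfl, hk⟩
      refine ⟨by rw [hp]; omega, ?_⟩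
      intro l' i' j' h
      rw [Finset.mem_insert] at h
      rcases h with h | h
      · simp only [Prod.mk.injEq] at h
        obtain ⟨rfl, rfl, rfl⟩ := h
        refine ⟨hl, fun i₂ hi j₂ hj => ?_⟩
        rw [Finset.mem_insert, hp]
        rcases Nat.eq_or_lt_of_le hi with e | e
        · subst e
          rcases Nat.eq_or_lt_of_le hj with e | e
          · left; rw [e]
          · right; exact e
        · right
          have h5 := hk (i' - 1) (by omega)
          have := anti l' (show i₂ ≤ i' - 1 by omega)
          omega
      · exact ⟨(hS _ _ _ h).1, fun i₂ hi j₂ hj =>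
          Finset.mem_insert_of_mem ((hS _ _ _ h).2 _ hi _ hj)⟩
  have heq : addable m S = (rem m S).image (fun c => ((c.1, c.2.1 + 1, p c.1 (c.2.1+1)) : Cell)) ∪
      (Finset.range m).image (fun l => ((l, 0, p l 0) : Cell)) := by
    ext ⟨l, i, j⟩
    rw [hadd, Finset.mem_union, Finset.mem_image, Finset.mem_image]
    constructor
    · rintro ⟨hl, rfl, hk⟩
      cases i with
      | zero => right; exact ⟨l, by simpa using hl, rfl⟩
      | succ k =>
        left
        have := hk k rfl
        exact ⟨(l, k, p l k - 1), (hrem _ _ _).2 ⟨by omega, by omega⟩, rfl⟩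
    · rintro (⟨⟨l', i', j'⟩, h, e⟩ | ⟨l', h, e⟩)
      · simp only [Prod.mk.injEq] at e
        obtain ⟨rfl, rfl, rfl⟩ := e
        have h6 := (hrem _ _ _).1 h
        have h7 := (mem_rem.1 h).1
        refine ⟨(hS _ _ _ h7).1, rfl, ?_⟩
        intro k hk
        have : k = i' := by omega
        subst this
        omega
      · simp only [Prod.mk.injEq] at e
        obtain ⟨rfl, rfl, rfl⟩ := e
        exact ⟨by simpa using h, rfl, fun k hk => by omega⟩
  rw [heq, Finset.card_union_of_disjoint, Finset.card_image_of_injOn,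
    Finset.card_image_of_injective, Finset.card_range]
  · intro a b h
    simp at h
    exact h.1
  · rintro ⟨l, i, j⟩ h ⟨l', i', j'⟩ h' e
    have h1 := (hrem _ _ _).1 h
    have h2 := (hrem _ _ _).1 h'
    simp only [Prod.mk.injEq] at e
    obtain ⟨rfl, e, -⟩ := e
    have : i = i' := by omega
    subst this
    have : j = j' := by omega
    rw [this]
  · rw [Finset.disjoint_left]
    intro x h h'
    obtain ⟨c, -, rfl⟩ := Finset.mem_image.1 h
    obtain ⟨c', -, e⟩ := Finset.mem_image.1 h'
    simp at e

/-- number of standard tableaux -/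
noncomputable def f (m : ℕ) : ℕ → Finset Cell → ℕ
  | 0, S => if S = ∅ then 1 else 0
  | n+1, S => ∑ b ∈ rem m S, f m n (S.erase b)

theorem swap_sum {m : ℕ} {S : Finset Cell} (hS : Low m S) (g : Finset Cell → ℕ) :
    ∑ a ∈ addable m S, ∑ b ∈ rem m (insert a S), g ((insert a S).erase b) =
      (addable m S).card * g S +
      ∑ b ∈ rem m S, ∑ a ∈ (addable m (S.erase b)).erase b, g (insert a (S.erase b)) := by
  have h1 : ∀ a ∈ addable m S, ∑ b ∈ rem m (insert a S), g ((insert a S).erase b) =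
      g S + ∑ b ∈ (rem m (insert a S)).erase a, g ((insert a S).erase b) := by
    intro a ha
    have ha' := mem_add.1 ha
    have : a ∈ rem m (insert a S) := by
      rw [mem_rem, Finset.erase_insert ha'.1]
      exact ⟨Finset.mem_insert_self _ _, hS⟩
    rw [← Finset.add_sum_erase _ _ this, Finset.erase_insert ha'.1]
  rw [Finset.sum_congr rfl h1, Finset.sum_add_distrib, Finset.sum_const, smul_eq_mul]
  congr 1
  rw [Finset.sum_sigma', Finset.sum_sigma']
  refine Finset.sum_nbij' (fun x => ⟨x.2, x.1⟩) (fun x => ⟨x.2, x.1⟩) ?_ ?_ ?_ ?_ ?_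
  · rintro ⟨a, b⟩ h
    simp only [Finset.mem_sigma, Finset.mem_erase, mem_add, mem_rem, Finset.mem_insert] at h ⊢
    obtain ⟨⟨h1, h2⟩, h3, h4, h5⟩ := h
    have hb : b ∈ S := by tauto
    rw [Finset.erase_insert_of_ne (Ne.symm h3)] at h5
    refine ⟨⟨hb, ?_⟩, Ne.symm h3, by tauto, h5⟩
    have := low_inter hS h5
    convert this using 1
    ext x
    simp only [Finset.mem_erase, Finset.mem_inter, Finset.mem_insert]
    constructor
    · tauto
    · rintro ⟨h, rfl | h'⟩
      · exact absurd h h1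
      · tauto
  · rintro ⟨b, a⟩ h
    simp only [Finset.mem_sigma, Finset.mem_erase, mem_add, mem_rem, Finset.mem_insert] at h ⊢
    obtain ⟨⟨h1, h2⟩, h3, h4, h5⟩ := h
    have ha : a ∉ S := by tauto
    rw [Finset.erase_insert_of_ne h3]
    refine ⟨⟨ha, ?_⟩, Ne.symm h3, Or.inr h1, h5⟩
    have := low_union hS h5
    convert this using 1
    ext x
    simp only [Finset.mem_erase, Finset.mem_union, Finset.mem_insert]
    tauto
  · rintro ⟨a, b⟩ h; rfl
  · rintro ⟨a, b⟩ h; rfl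
  · rintro ⟨a, b⟩ h
    simp only [Finset.mem_sigma, Finset.mem_erase] at h
    simp only
    rw [Finset.erase_insert_of_ne (Ne.symm h.2.1)]

theorem up_sum (m : ℕ) : ∀ (n : ℕ) (S : Finset Cell), Low m S →
    ∑ a ∈ addable m S, f m (n+1) (insert a S) = (n+1) * m * f m n S := by
  intro n
  induction n with
  | zero =>
    intro S hS
    have h := swap_sum hS (f m 0)
    have h0 : ∀ a, ∀ T : Finset Cell, f m 0 (insert a T) = 0 := fun a T => by
      simp [f]
    simp only [h0, Finset.sum_const_zero, add_zero] at h
    refine Eq.trans ?_ (h.trans ?_)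
    · rfl
    · by_cases hE : S = ∅
      · subst hE
        have hr : rem m ∅ = ∅ := by
          ext b
          rw [mem_rem]
          simp
        rw [card_add hS, hr]
        simp
      · simp [f, hE]
  | succ n ih =>
    intro S hS
    have h := swap_sum hS (f m (n+1))
    refine Eq.trans (by rfl) (h.trans ?_)
    have h1 : ∑ b ∈ rem m S, ((∑ a ∈ (addable m (S.erase b)).erase b,
        f m (n+1) (insert a (S.erase b))) + f m (n+1) S) =
        (n+1) * m * f m (n+1) S := by
      conv_rhs => rw [f, Finset.mul_sum]
      apply Finset.sum_congr rfl
      intro b hb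
      have hb' := mem_rem.1 hb
      rw [← ih _ hb'.2]
      have : b ∈ addable m (S.erase b) := by
        rw [mem_add, Finset.insert_erase hb'.1]
        exact ⟨by simp, hS⟩
      rw [← Finset.sum_erase_add _ _ this, Finset.insert_erase hb'.1]
    rw [Finset.sum_add_distrib, Finset.sum_const, smul_eq_mul] at h1
    rw [card_add hS]
    linarith

theorem sum_sq (m n : ℕ) : ∑ S ∈ lev m n, f m n S * f m n S = n.factorial * m ^ n := by
  induction n with
  | zero =>
    have : lev m 0 = {∅} := by
      ext S
      rw [mem_lev, Finset.mem_singleton, Finset.card_eq_zero]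
      refine ⟨fun h => h.2, ?_⟩
      rintro rfl
      exact ⟨fun l i j h => by simp at h, rfl⟩
    rw [this]
    simp [f]
  | succ n ih =>
    have h1 : ∑ S ∈ lev m (n+1), f m (n+1) S * f m (n+1) S =
        ∑ S ∈ lev m (n+1), ∑ b ∈ rem m S, f m (n+1) S * f m n (S.erase b) := by
      refine Finset.sum_congr rfl fun S _ => ?_
      rw [← Finset.mul_sum]
      rfl
    have h2 : ∑ S ∈ lev m (n+1), ∑ b ∈ rem m S, f m (n+1) S * f m n (S.erase b) =
        ∑ Q ∈ lev m n, ∑ a ∈ addable m Q, f m (n+1) (insert a Q) * f m n Q := by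
      rw [Finset.sum_sigma', Finset.sum_sigma']
      refine Finset.sum_nbij' (fun x => ⟨x.1.erase x.2, x.2⟩) (fun x => ⟨insert x.2 x.1, x.2⟩)
        ?_ ?_ ?_ ?_ ?_
      · rintro ⟨S, b⟩ h
        simp only [Finset.mem_sigma, mem_lev, mem_rem, mem_add] at h ⊢
        obtain ⟨⟨h1, h2⟩, h3, h4⟩ := h
        rw [Finset.insert_erase h3, Finset.card_erase_of_mem h3, h2]
        exact ⟨⟨h4, rfl⟩, by simp, h1⟩
      · rintro ⟨S, b⟩ h
        simp only [Finset.mem_sigma, mem_lev, mem_rem, mem_add] at h ⊢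
        obtain ⟨⟨h1, h2⟩, h3, h4⟩ := h
        rw [Finset.erase_insert h3, Finset.card_insert_of_notMem h3, h2]
        exact ⟨⟨h4, rfl⟩, by simp, h1⟩
      · rintro ⟨S, b⟩ h
        simp only [Finset.mem_sigma, mem_lev, mem_rem, mem_add] at h ⊢
        rw [Finset.insert_erase h.2.1]
      · rintro ⟨S, b⟩ h
        simp only [Finset.mem_sigma, mem_lev, mem_rem, mem_add] at h ⊢
        rw [Finset.erase_insert h.2.1]
      · rintro ⟨S, b⟩ h
        simp only [Finset.mem_sigma, mem_lev, mem_rem, mem_add] at h ⊢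
        rw [Finset.insert_erase h.2.1]
    have h3 : ∑ Q ∈ lev m n, ∑ a ∈ addable m Q, f m (n+1) (insert a Q) * f m n Q =
        (n+1) * m * ∑ Q ∈ lev m n, f m n Q * f m n Q := by
      rw [Finset.mul_sum]
      refine Finset.sum_congr rfl fun Q hQ => ?_
      rw [← Finset.sum_mul, up_sum m n Q (mem_lev.1 hQ).1, mul_assoc]
    rw [h1, h2, h3, ih, Nat.factorial_succ, pow_succ]
    ring

def StdSet (C : Set Cell) (n : ℕ) (t : Cell → ℕ) : Prop :=
  Set.BijOn t C (Set.Icc 1 n) ∧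
  (∀ b ∈ C, ∀ b' ∈ C,
      b.1 = b'.1 → b.2.1 = b'.2.1 → b.2.2 < b'.2.2 → t b < t b') ∧
  (∀ b ∈ C, ∀ b' ∈ C,
      b.1 = b'.1 → b.2.2 = b'.2.2 → b.2.1 < b'.2.1 → t b < t b') ∧
  (∀ b, b ∉ C → t b = 0)

open Classical in
noncomputable def tab (m : ℕ) : ℕ → Finset Cell → Finset (Cell → ℕ)
  | 0, S => if S = ∅ then {fun _ => 0} else ∅
  | n+1, S => (rem m S).biUnion fun b =>
      (tab m n (S.erase b)).image fun t => Function.update t b (n+1)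

theorem std_le {C : Set Cell} {n : ℕ} {t : Cell → ℕ} (h : StdSet C n t) (c : Cell) : t c ≤ n := by
  by_cases hc : c ∈ C
  · exact (h.1.mapsTo hc).2
  · rw [h.2.2.2 c hc]; omega

theorem std_extend {m n : ℕ} {S : Finset Cell} {b : Cell} {t : Cell → ℕ}
    (hS : Low m S) (hb : b ∈ rem m S) (h : StdSet (S.erase b : Finset Cell) n t) :
    StdSet S (n+1) (Function.update t b (n+1)) := by
  obtain ⟨hbS, hlow⟩ := mem_rem.1 hb
  have hle := std_le h
  obtain ⟨⟨hm, hi, hs⟩, hr, hc, hz⟩ := h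
  have hmem : ∀ c ∈ S, c ≠ b → c ∈ ((S.erase b : Finset Cell) : Set Cell) := fun c h1 h2 => by
    simp [h1, h2]
  refine ⟨⟨?_, ?_, ?_⟩, ?_, ?_, ?_⟩
  · intro c hc
    by_cases e : c = b
    · subst e; simp
    · rw [Function.update_of_ne e]
      have := hm (hmem c hc e)
      exact ⟨this.1, this.2.trans (by omega)⟩
  · intro c hc c' hc' heq
    by_cases e : c = b
    · by_cases e' : c' = b
      · rw [e, e']
      · subst e
        rw [Function.update_self, Function.update_of_ne e'] at heq
        have := hle c'
        omega
    · by_cases e' : c' = b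
      · subst e'
        rw [Function.update_self, Function.update_of_ne e] at heq
        have := hle c
        omega
      · rw [Function.update_of_ne e, Function.update_of_ne e'] at heq
        exact hi (hmem c hc e) (hmem c' hc' e') heq
  · intro k hk
    by_cases e : k = n + 1
    · exact ⟨b, hbS, by simp [e]⟩
    · obtain ⟨c, hc, rfl⟩ := hs (show k ∈ Set.Icc 1 n from ⟨hk.1, by have := hk.2; omega⟩)
      have hc2 : c ≠ b ∧ c ∈ S := Finset.mem_erase.1 hc
      exact ⟨c, hc2.2, by rw [Function.update_of_ne hc2.1]⟩
  · intro c hcS c' hcS' e1 e2 e3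
    by_cases e' : c' = b
    · subst e'
      have hne : c ≠ c' := by rintro rfl; omega
      rw [Function.update_self, Function.update_of_ne hne]
      exact Nat.lt_succ_of_le (hle c)
    · by_cases e : c = b
      · exfalso
        subst e
        obtain ⟨l, i, j⟩ := c
        obtain ⟨l', i', j'⟩ := c'
        simp only at e1 e2 e3
        subst e1 e2
        have := (hlow l i j' (hmem _ hcS' e')).2 i le_rfl j (le_of_lt e3)
        simp at this
      · rw [Function.update_of_ne e, Function.update_of_ne e']
        exact hr _ (hmem c hcS e) _ (hmem c' hcS' e') e1 e2 e3
  · intro c hcS c' hcS' e1 e2 e3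
    by_cases e' : c' = b
    · subst e'
      have hne : c ≠ c' := by rintro rfl; omega
      rw [Function.update_self, Function.update_of_ne hne]
      exact Nat.lt_succ_of_le (hle c)
    · by_cases e : c = b
      · exfalso
        subst e
        obtain ⟨l, i, j⟩ := c
        obtain ⟨l', i', j'⟩ := c'
        simp only at e1 e2 e3
        subst e1 e2
        have := (hlow l i' j (hmem _ hcS' e')).2 i (le_of_lt e3) j le_rfl
        simp at this
      · rw [Function.update_of_ne e, Function.update_of_ne e']
        exact hc _ (hmem c hcS e) _ (hmem c' hcS' e') e1 e2 e3
  · intro c hcS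
    have hne : c ≠ b := by rintro rfl; exact hcS hbS
    rw [Function.update_of_ne hne]
    apply hz
    simp only [Finset.mem_coe] at hcS
    simp [hcS]

theorem std_restrict {m n : ℕ} {S : Finset Cell} {t : Cell → ℕ}
    (hS : Low m S) (h : StdSet S (n+1) t) :
    ∃ b ∈ rem m S, t b = n + 1 ∧ StdSet (S.erase b : Finset Cell) n (Function.update t b 0) := by
  obtain ⟨⟨hm, hi, hs⟩, hr, hc, hz⟩ := h
  obtain ⟨b, hbS, hb⟩ := hs (show n + 1 ∈ Set.Icc 1 (n+1) from ⟨by omega, le_rfl⟩)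
  have hmem : ∀ c, c ∈ ((S.erase b : Finset Cell) : Set Cell) ↔ c ≠ b ∧ c ∈ S :=
    fun c => Finset.mem_erase
  have hlt : ∀ l i j i' j', (l, i, j) ∈ S → i' ≤ i → j' ≤ j → t (l, i', j') ≤ t (l, i, j) := by
    intro l i j i' j' h1 h2 h3
    have h4 : t (l, i', j') ≤ t (l, i', j) := by
      rcases Nat.eq_or_lt_of_le h3 with e | e
      · rw [e]
      · exact le_of_lt (hr _ ((hS _ _ _ h1).2 _ h2 _ h3) _ ((hS _ _ _ h1).2 _ h2 _ le_rfl) rfl rfl e)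
    have h5 : t (l, i', j) ≤ t (l, i, j) := by
      rcases Nat.eq_or_lt_of_le h2 with e | e
      · rw [e]
      · exact le_of_lt (hc _ ((hS _ _ _ h1).2 _ h2 _ le_rfl) _ h1 rfl rfl e)
    exact h4.trans h5
  refine ⟨b, mem_rem.2 ⟨hbS, ?_⟩, hb, ⟨?_, ?_, ?_⟩, ?_, ?_, ?_⟩
  · intro l i j h
    rw [Finset.mem_erase] at h
    refine ⟨(hS _ _ _ h.2).1, fun i' hi' j' hj' => ?_⟩
    rw [Finset.mem_erase]
    refine ⟨?_, (hS _ _ _ h.2).2 _ hi' _ hj'⟩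
    rintro rfl
    have h1 := hlt _ _ _ _ _ h.2 hi' hj'
    have h2 := (hm h.2).2
    exact h.1 (hi h.2 hbS (by omega))
  · intro c hc
    rw [hmem] at hc
    rw [Function.update_of_ne hc.1]
    have h1 := hm hc.2
    refine ⟨h1.1, ?_⟩
    have : t c ≠ n + 1 := fun e => hc.1 (hi hc.2 hbS (e.trans hb.symm))
    have := h1.2
    omega
  · intro c hc c' hc' e
    rw [hmem] at hc hc'
    rw [Function.update_of_ne hc.1, Function.update_of_ne hc'.1] at e
    exact hi hc.2 hc'.2 e
  · intro k hk
    obtain ⟨c, hc, rfl⟩ := hs (show k ∈ Set.Icc 1 (n+1) from ⟨hk.1, by have := hk.2; omega⟩)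
    have hne : c ≠ b := by
      rintro rfl
      have := hk.2
      omega
    exact ⟨c, (hmem c).2 ⟨hne, hc⟩, by rw [Function.update_of_ne hne]⟩
  · intro c hcS c' hcS' e1 e2 e3
    rw [hmem] at hcS hcS'
    rw [Function.update_of_ne hcS.1, Function.update_of_ne hcS'.1]
    exact hr _ hcS.2 _ hcS'.2 e1 e2 e3
  · intro c hcS c' hcS' e1 e2 e3
    rw [hmem] at hcS hcS'
    rw [Function.update_of_ne hcS.1, Function.update_of_ne hcS'.1]
    exact hc _ hcS.2 _ hcS'.2 e1 e2 e3
  · intro c hcS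
    rw [hmem] at hcS
    by_cases e : c = b
    · subst e; simp
    · rw [Function.update_of_ne e]
      exact hz c (fun h => hcS ⟨e, h⟩)

theorem mem_tab {m : ℕ} : ∀ {n : ℕ} {S : Finset Cell} {t : Cell → ℕ}, Low m S →
    (t ∈ tab m n S ↔ StdSet S n t) := by
  intro n
  induction n with
  | zero =>
    intro S t hS
    by_cases hE : S = ∅
    · subst hE
      simp only [tab, if_true, Finset.mem_singleton]
      constructor
      · rintro rfl
        simp [StdSet]
      · intro h
        funext c
        exact h.2.2.2 c (by simp)
    · simp only [tab, hE, if_false, Finset.notMem_empty, false_iff]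
      intro h
      obtain ⟨c, hc⟩ := Finset.nonempty_iff_ne_empty.2 hE
      have := h.1.mapsTo hc
      have h1 := this.1
      have h2 := this.2
      omega
  | succ n ih =>
    intro S t hS
    simp only [tab, Finset.mem_biUnion, Finset.mem_image]
    constructor
    · rintro ⟨b, hb, t', ht', rfl⟩
      exact std_extend hS hb ((ih (mem_rem.1 hb).2).1 ht')
    · intro h
      obtain ⟨b, hb, e, h'⟩ := std_restrict hS h
      refine ⟨b, hb, _, (ih (mem_rem.1 hb).2).2 h', ?_⟩
      rw [Function.update_idem, ← e, Function.update_eq_self]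

theorem card_tab {m : ℕ} : ∀ {n : ℕ} {S : Finset Cell}, Low m S →
    (tab m n S).card = f m n S := by
  classical
  intro n
  induction n with
  | zero =>
    intro S hS
    by_cases hE : S = ∅ <;> simp [tab, f, hE]
  | succ n ih =>
    intro S hS
    rw [tab, f, Finset.card_biUnion]
    · refine Finset.sum_congr rfl fun b hb => ?_
      have hl := (mem_rem.1 hb).2
      rw [← ih hl, Finset.card_image_of_injOn]
      intro t ht t' ht' e
      have h1 := (mem_tab hl).1 ht
      have h2 := (mem_tab hl).1 ht'
      have z1 := h1.2.2.2 b (by simp)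
      have z2 := h2.2.2.2 b (by simp)
      funext c
      by_cases hc : c = b
      · rw [hc, z1, z2]
      · have := congrFun e c
        simpa [Function.update_of_ne hc] using this
    · intro b hb b' hb' hne
      rw [Function.onFun, Finset.disjoint_left]
      intro t ht ht'
      obtain ⟨u, hu, rfl⟩ := Finset.mem_image.1 ht
      obtain ⟨u', hu', e⟩ := Finset.mem_image.1 ht'
      have h2 := std_le ((mem_tab (mem_rem.1 hb').2).1 hu')
      have := congrFun e b
      simp only [Function.update_self] at this
      rw [Function.update_of_ne hne] at this
      have := h2 b
      omega

end RSProof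

namespace RSProof
open MultiShape

theorem cells_ord {Λ : MultiShape} {m : ℕ} (h : IsOrdinaryMulti Λ m) (l i j : ℕ) :
    (l, i, j) ∈ Λ.cells ↔ l < m ∧ j < Λ.part l i := by
  obtain ⟨h1, h2, h3⟩ := h
  simp [cells, h1, h2]

theorem low_ord {Λ : MultiShape} {m : ℕ} (h : IsOrdinaryMulti Λ m) (hf : Λ.cells.Finite) :
    Low m hf.toFinset := by
  intro l i j hc
  rw [Set.Finite.mem_toFinset, cells_ord h] at hc
  refine ⟨hc.1, fun i' hi j' hj => ?_⟩
  rw [Set.Finite.mem_toFinset, cells_ord h]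
  obtain ⟨h1, h2, h3⟩ := h
  have := h3.2.1 l (by omega) (by rw [h2]) hi
  exact ⟨hc.1, by omega⟩

theorem ord_ext {Λ Λ' : MultiShape} {m : ℕ} (h : IsOrdinaryMulti Λ m) (h' : IsOrdinaryMulti Λ' m)
    (e : Λ.cells = Λ'.cells) : Λ = Λ' := by
  have hp : Λ.part = Λ'.part := by
    funext l i
    by_cases hl : l < m
    · have key : ∀ j, j < Λ.part l i ↔ j < Λ'.part l i := by
        intro j
        have h1 := cells_ord h l i j
        have h2 := cells_ord h' l i j
        rw [e] at h1
        tauto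
      have a := key (Λ.part l i)
      have b := key (Λ'.part l i)
      omega
    · rw [(h.2.2.2.2 l (by rw [h.1]; omega)).1, (h'.2.2.2.2 l (by rw [h'.1]; omega)).1]
  obtain ⟨h1, h2, -⟩ := h
  obtain ⟨h1', h2', -⟩ := h'
  cases Λ
  cases Λ'
  simp_all

theorem exists_ord {m : ℕ} {S : Finset Cell} (hS : Low m S) :
    ∃ Λ : MultiShape, IsOrdinaryMulti Λ m ∧ Λ.cells = S := by
  obtain ⟨p, hp, anti, hz⟩ := exists_rows hS
  have ho : IsOrdinaryMulti ⟨m, fun _ => false, p⟩ m :=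
    ⟨rfl, rfl, fun l _ h => by simp at h, fun l _ _ => anti l,
      fun l hl => ⟨funext (hz l hl), rfl⟩⟩
  refine ⟨_, ho, ?_⟩
  ext ⟨l, i, j⟩
  rw [cells_ord ho, Finset.mem_coe, hp]
  refine ⟨fun h => h.2, fun h => ⟨?_, h⟩⟩
  exact (hS _ _ _ ((hp l i j).2 h)).1

end RSProof

open MultiShape in
/-- `Σ_{λ ∈ P^m_n} |Std(λ)|² = n! mⁿ`, expressed as a count of triples
`(λ, s, t)` with `λ` an `m`-multipartition of `n` and `s, t ∈ Std(λ)`. -/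
theorem stmt7 (n m : ℕ) (hn : 0 < n) (hm : 0 < m) :
    Nat.card {x : MultiShape × ((ℕ × ℕ × ℕ) → ℕ) × ((ℕ × ℕ × ℕ) → ℕ) //
        IsOrdinaryMulti x.1 m ∧ x.1.cells.Finite ∧ x.1.cells.ncard = n ∧
        x.1.IsStd n x.2.1 ∧ x.1.IsStd n x.2.2} =
      n.factorial * m ^ n := by
  classical
  let B : Finset ((_ : Finset RSProof.Cell) × ((RSProof.Cell → ℕ) × (RSProof.Cell → ℕ))) :=
    (RSProof.lev m n).sigma fun S => RSProof.tab m n S ×ˢ RSProof.tab m n S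
  have hB : B.card = n.factorial * m ^ n := by
    rw [← RSProof.sum_sq, Finset.card_sigma]
    refine Finset.sum_congr rfl fun S hS => ?_
    rw [Finset.card_product, RSProof.card_tab (RSProof.mem_lev.1 hS).1]
  have hB2 : Nat.card (B : Set ((_ : Finset RSProof.Cell) × ((RSProof.Cell → ℕ) × (RSProof.Cell → ℕ)))) =
      B.card := by
    rw [Nat.card_coe_set_eq, Set.ncard_coe_finset]
  rw [← hB, ← hB2]
  refine Nat.card_eq_of_bijective (fun x => ⟨⟨x.2.2.1.toFinset, x.1.2⟩, ?_⟩) ⟨?_, ?_⟩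
  · obtain ⟨⟨Λ, s, t⟩, ho, hf, hc, hs, ht⟩ := x
    have hl := RSProof.low_ord ho hf
    have e : ((hf.toFinset : Finset RSProof.Cell) : Set RSProof.Cell) = Λ.cells := hf.coe_toFinset
    simp only [B, Finset.mem_coe, Finset.mem_sigma, Finset.mem_product, RSProof.mem_lev,
      RSProof.mem_tab hl, e]
    exact ⟨⟨hl, (Set.ncard_eq_toFinset_card _ hf).symm.trans hc⟩, hs, ht⟩
  · rintro ⟨⟨Λ, s, t⟩, ho, hf, hc, hs, ht⟩ ⟨⟨Λ', s', t'⟩, ho', hf', hc', hs', ht'⟩ h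
    simp only [Subtype.mk.injEq, Sigma.mk.injEq, heq_eq_eq, Prod.mk.injEq,
      Set.Finite.toFinset_inj] at h
    obtain ⟨h1, rfl, rfl⟩ := h
    have := RSProof.ord_ext ho ho' h1
    subst this
    rfl
  · rintro ⟨⟨S, s, t⟩, h⟩
    simp only [B, Finset.mem_coe, Finset.mem_sigma, Finset.mem_product, RSProof.mem_lev] at h
    obtain ⟨⟨hl, hc⟩, hs, ht⟩ := h
    rw [RSProof.mem_tab hl] at hs ht
    obtain ⟨Λ, ho, e⟩ := RSProof.exists_ord hl
    rw [← e] at hs ht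
    have hf : Λ.cells.Finite := by rw [e]; exact S.finite_toSet
    refine ⟨⟨⟨Λ, s, t⟩, ho, hf, ?_, hs, ht⟩, ?_⟩
    · simp only [e, Set.ncard_coe_finset, hc]
    · simp only [Subtype.mk.injEq, Sigma.mk.injEq, heq_eq_eq, Prod.mk.injEq, and_true]
      ext c
      simp [e]
end

section
/- Let K be an algebraically closed field of characteristic ≠ 2 and for each z ∈ K*, let U(z) be the 2-dimensional module over the rank-1 Clifford-Laurent algebra A₁ (generated by invertible even X₁ and odd C₁ with C₁² = 1 and X₁C₁ = C₁X₁⁻¹) with basis u₀, u₁, X₁u₀ = z u₀, X₁u₁ = z⁻¹u₁, C₁u₀ = u₁, C₁u₁ = u₀. Then U(z) ≅ U(z') as A₁-supermodules if and only if z' = z or z' = z⁻¹, and every finite-dimensional irreducible A₁-supermodule is isomorphic to some U(z). Moreover U(z) is of type Q if z² = 1 and of type M otherwise. -/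
/-- A supermodule over the rank-1 Clifford–Laurent superalgebra `A₁`
(even invertible generator `X₁`, odd generator `C₁`, relations `C₁² = 1`,
`X₁C₁ = C₁X₁⁻¹`): a `K`-vector space with an invertible operator `X`, an
operator `C`, and a parity operator `P` (`P² = 1`, `P` commutes with the even
`X` and anticommutes with the odd `C`). -/
structure A1Str (K V : Type) [Field K] [AddCommGroup V] [Module K V] where
  X : V ≃ₗ[K] V
  C : V →ₗ[K] V
  P : V →ₗ[K] V
  hC : ∀ v, C (C v) = v
  hXC : ∀ v, X (C v) = C (X.symm v)
  hP : ∀ v, P (P v) = v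
  hPX : ∀ v, P (X v) = X (P v)
  hPC : ∀ v, P (C v) = -C (P v)

/-- Isomorphism of `A₁`-supermodules (up to parity change `Π`): an invertible
even or odd homomorphism. -/
def A1Iso {K V W : Type} [Field K] [AddCommGroup V] [Module K V]
    [AddCommGroup W] [Module K W] (S : A1Str K V) (S' : A1Str K W) : Prop :=
  ∃ e : V ≃ₗ[K] W,
    ((∀ v, e (S.X v) = S'.X (e v)) ∧ (∀ v, e (S.C v) = S'.C (e v)) ∧
        ∀ v, e (S.P v) = S'.P (e v)) ∨
    ((∀ v, e (S.X v) = S'.X (e v)) ∧ (∀ v, e (S.C v) = -S'.C (e v)) ∧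
        ∀ v, e (S.P v) = -S'.P (e v))

/-- Irreducibility of an `A₁`-supermodule: it is nonzero and has no proper
nonzero graded submodule invariant under `X, X⁻¹, C`. -/
def A1Irred {K V : Type} [Field K] [AddCommGroup V] [Module K V]
    (S : A1Str K V) : Prop :=
  (∃ v : V, v ≠ 0) ∧
  ∀ W' : Submodule K V, (∀ v ∈ W', S.X v ∈ W') → (∀ v ∈ W', S.X.symm v ∈ W') →
    (∀ v ∈ W', S.C v ∈ W') → (∀ v ∈ W', S.P v ∈ W') → W' = ⊥ ∨ W' = ⊤

/-- The endomorphism superalgebra of an `A₁`-supermodule: the span of the even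
endomorphisms (commuting with `X, C, P`) and odd endomorphisms (commuting with
`X`, anticommuting with `C` and `P`). -/
def superEnd {K V : Type} [Field K] [AddCommGroup V] [Module K V]
    (S : A1Str K V) : Submodule K (V →ₗ[K] V) :=
  Submodule.span K
    ({f : V →ₗ[K] V | (∀ v, f (S.X v) = S.X (f v)) ∧
        (∀ v, f (S.C v) = S.C (f v)) ∧ ∀ v, f (S.P v) = S.P (f v)} ∪
      {f : V →ₗ[K] V | (∀ v, f (S.X v) = S.X (f v)) ∧
        (∀ v, f (S.C v) = -S.C (f v)) ∧ ∀ v, f (S.P v) = -S.P (f v)})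

/-- The `A₁`-supermodule `U(z)` on `K²` with basis `u₀` (even), `u₁` (odd):
`X₁u₀ = zu₀`, `X₁u₁ = z⁻¹u₁`, `C₁u₀ = u₁`, `C₁u₁ = u₀`. -/
noncomputable def Umod (K : Type) [Field K] (z : K) (hz : z ≠ 0) :
    A1Str K (K × K) where
  X := LinearEquiv.ofLinear
    (LinearMap.prodMap (z • (LinearMap.id : K →ₗ[K] K))
      (z⁻¹ • (LinearMap.id : K →ₗ[K] K)))
    (LinearMap.prodMap (z⁻¹ • (LinearMap.id : K →ₗ[K] K))
      (z • (LinearMap.id : K →ₗ[K] K)))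
    (by
      ext <;>
        simp [mul_comm, mul_assoc, mul_inv_cancel₀ hz, inv_mul_cancel₀ hz])
    (by
      ext <;>
        simp [mul_comm, mul_assoc, mul_inv_cancel₀ hz, inv_mul_cancel₀ hz])
  C := (LinearMap.snd K K K).prod (LinearMap.fst K K K)
  P := LinearMap.prodMap (LinearMap.id : K →ₗ[K] K) (-(LinearMap.id : K →ₗ[K] K))
  hC := by intro v; simp
  hXC := by
    intro v
    simp [mul_comm]
  hP := by intro v; simp
  hPX := by
    intro v
    simp [mul_comm]
  hPC := by
    intro v
    simp [Prod.ext_iff]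


theorem Umod_X (K : Type) [Field K] (z : K) (hz : z ≠ 0) (p : K × K) :
    (Umod K z hz).X p = (z * p.1, z⁻¹ * p.2) := rfl

theorem Umod_C (K : Type) [Field K] (z : K) (hz : z ≠ 0) (p : K × K) :
    (Umod K z hz).C p = (p.2, p.1) := rfl

theorem Umod_P (K : Type) [Field K] (z : K) (hz : z ≠ 0) (p : K × K) :
    (Umod K z hz).P p = (p.1, -p.2) := rfl

theorem eq_zero_of_eq_neg {K : Type} [Field K] (h2 : (2 : K) ≠ 0) {a : K} (h : a = -a) :
    a = 0 := by
  have h3 : 2 * a = 0 := by linear_combination h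
  exact (mul_eq_zero.mp h3).resolve_left h2

/-- The odd operator `u₀ ↦ u₁`, `u₁ ↦ -u₀`. -/
def Jmap (K : Type) [Field K] : K × K →ₗ[K] K × K :=
  (-(LinearMap.snd K K K)).prod (LinearMap.fst K K K)

theorem Jmap_apply (K : Type) [Field K] (p : K × K) : Jmap K p = (-p.2, p.1) := rfl

theorem even_form {K : Type} [Field K] (h2 : (2 : K) ≠ 0) {z z' : K} (hz : z ≠ 0)
    (hz' : z' ≠ 0) (f : K × K →ₗ[K] K × K)
    (hC : ∀ v, f ((Umod K z hz).C v) = (Umod K z' hz').C (f v))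
    (hP : ∀ v, f ((Umod K z hz).P v) = (Umod K z' hz').P (f v)) :
    ∃ a : K, f = a • LinearMap.id := by
  have h1 := hP (1, 0)
  have h3 := hC (1, 0)
  simp only [Umod_P, Umod_C, neg_zero] at h1 h3
  have h4 : (f (1, 0)).2 = 0 := eq_zero_of_eq_neg h2 (congrArg Prod.snd h1)
  refine ⟨(f (1, 0)).1, ?_⟩
  ext <;> simp [h3, h4]

theorem odd_form {K : Type} [Field K] (h2 : (2 : K) ≠ 0) {z z' : K} (hz : z ≠ 0)
    (hz' : z' ≠ 0) (f : K × K →ₗ[K] K × K)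
    (hC : ∀ v, f ((Umod K z hz).C v) = -(Umod K z' hz').C (f v))
    (hP : ∀ v, f ((Umod K z hz).P v) = -(Umod K z' hz').P (f v)) :
    ∃ a : K, f = a • Jmap K := by
  have h1 := hP (1, 0)
  have h3 := hC (1, 0)
  simp only [Umod_P, Umod_C, neg_zero] at h1 h3
  have h4 : (f (1, 0)).1 = 0 := eq_zero_of_eq_neg h2 (congrArg Prod.fst h1)
  refine ⟨(f (1, 0)).2, ?_⟩
  ext <;> simp [h3, h4, Jmap_apply]

theorem iso_part {K : Type} [Field K] (h2 : (2 : K) ≠ 0) (z z' : K) (hz : z ≠ 0)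
    (hz' : z' ≠ 0) :
    A1Iso (Umod K z hz) (Umod K z' hz') ↔ (z' = z ∨ z' = z⁻¹) := by
  constructor
  · rintro ⟨e, ⟨hX, hC, hP⟩ | ⟨hX, hC, hP⟩⟩
    · left
      obtain ⟨a, ha⟩ := even_form h2 hz hz' e.toLinearMap hC hP
      have he : ∀ v, e v = a • v := fun v => by
        have := LinearMap.congr_fun ha v
        simpa using this
      have ha0 : a ≠ 0 := by
        rintro rfl
        have h : e (1, 0) = e 0 := by rw [he, he]; simp
        have := e.injective h
        simp at this
      have h := hX (1, 0)
      simp only [Umod_X, he] at h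
      have h5 := congrArg Prod.fst h
      simp at h5
      have : a * (z' - z) = 0 := by linear_combination -h5
      exact sub_eq_zero.mp ((mul_eq_zero.mp this).resolve_left ha0)
    · right
      obtain ⟨a, ha⟩ := odd_form h2 hz hz' e.toLinearMap hC hP
      have he : ∀ v, e v = a • Jmap K v := fun v => by
        have := LinearMap.congr_fun ha v
        simpa using this
      have ha0 : a ≠ 0 := by
        rintro rfl
        have h : e (1, 0) = e 0 := by rw [he, he]; simp
        have := e.injective h
        simp at this
      have h := hX (0, 1)
      simp only [Umod_X, he, Jmap_apply] at h
      have h5 := congrArg Prod.fst h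
      simp at h5
      have : a * (z' - z⁻¹) = 0 := by linear_combination -h5
      exact sub_eq_zero.mp ((mul_eq_zero.mp this).resolve_left ha0)
  · rintro (rfl | rfl)
    · exact ⟨LinearEquiv.refl K _, Or.inl ⟨fun _ => rfl, fun _ => rfl, fun _ => rfl⟩⟩
    · refine ⟨LinearEquiv.ofLinear (Jmap K) (-Jmap K) ?_ ?_, Or.inr ⟨?_, ?_, ?_⟩⟩
      · ext <;> simp [Jmap_apply]
      · ext <;> simp [Jmap_apply]
      · intro v; simp [Jmap_apply, Umod_X]
      · intro v; simp [Jmap_apply, Umod_C]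
      · intro v; simp [Jmap_apply, Umod_P]

theorem type_part {K : Type} [Field K] (h2 : (2 : K) ≠ 0) (z : K) (hz : z ≠ 0) :
    (z ^ 2 = 1 → Module.finrank K (superEnd (Umod K z hz)) = 2) ∧
    (z ^ 2 ≠ 1 → Module.finrank K (superEnd (Umod K z hz)) = 1) := by
  have hid : (LinearMap.id : K × K →ₗ[K] K × K) ∈ superEnd (Umod K z hz) :=
    Submodule.subset_span (Or.inl ⟨fun _ => rfl, fun _ => rfl, fun _ => rfl⟩)
  constructor
  · intro hz2
    have hzi : z⁻¹ = z := by
      exact inv_eq_of_mul_eq_one_left (by rw [← hz2]; ring)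
    have hJ : Jmap K ∈ superEnd (Umod K z hz) := by
      refine Submodule.subset_span (Or.inr ⟨?_, ?_, ?_⟩)
      · intro v; simp [Jmap_apply, Umod_X, hzi]
      · intro v; simp [Jmap_apply, Umod_C]
      · intro v; simp [Jmap_apply, Umod_P]
    have hs : superEnd (Umod K z hz)
        = Submodule.span K (Set.range ![LinearMap.id, Jmap K]) := by
      apply le_antisymm
      · refine Submodule.span_le.mpr ?_
        rintro f (⟨_, hC, hP⟩ | ⟨_, hC, hP⟩)
        · obtain ⟨a, rfl⟩ := even_form h2 hz hz f hC hP
          exact Submodule.smul_mem _ _ (Submodule.subset_span ⟨0, rfl⟩)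
        · obtain ⟨a, rfl⟩ := odd_form h2 hz hz f hC hP
          exact Submodule.smul_mem _ _ (Submodule.subset_span ⟨1, rfl⟩)
      · refine Submodule.span_le.mpr ?_
        rintro _ ⟨i, rfl⟩
        fin_cases i
        · exact hid
        · exact hJ
    have hli : LinearIndependent K ![(LinearMap.id : K × K →ₗ[K] K × K), Jmap K] := by
      rw [LinearIndependent.pair_iff]
      intro s t h
      have := LinearMap.congr_fun h (1, 0)
      simpa [Jmap_apply] using this
    rw [hs, finrank_span_eq_card hli]
    simp
  · intro hz2
    have hs : superEnd (Umod K z hz) = Submodule.span K {LinearMap.id} := by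
      apply le_antisymm
      · refine Submodule.span_le.mpr ?_
        rintro f (⟨_, hC, hP⟩ | ⟨hX, hC, hP⟩)
        · obtain ⟨a, rfl⟩ := even_form h2 hz hz f hC hP
          exact Submodule.smul_mem _ _ (Submodule.subset_span rfl)
        · obtain ⟨a, rfl⟩ := odd_form h2 hz hz f hC hP
          have h := congrArg Prod.snd (hX (1, 0))
          simp [Umod_X, Jmap_apply] at h
          have ha : a = 0 := by
            by_contra ha
            apply hz2
            field_simp at h
            first | exact h.symm | exact h
          rw [ha, zero_smul]
          exact Submodule.zero_mem _
      · refine Submodule.span_le.mpr ?_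
        rintro _ rfl
        exact hid
    rw [hs, finrank_span_singleton]
    intro h
    have := LinearMap.congr_fun h (1, 0)
    simp at this

theorem irred_part {K : Type} [Field K] [IsAlgClosed K] (h2 : (2 : K) ≠ 0)
    (V : Type) [AddCommGroup V] [Module K V] (S : A1Str K V)
    (hfd : FiniteDimensional K V) (hirr : A1Irred S) :
    ∃ (z : K) (hz : z ≠ 0), A1Iso S (Umod K z hz) := by
  obtain ⟨⟨v, hv⟩, hsub⟩ := hirr
  have hself : ∀ w : V, w = -w → w = 0 := fun w hw => by
    have h3 : (2 : K) • w = 0 := by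
      rw [two_smul]; nth_rewrite 1 [hw]; simp
    exact (smul_eq_zero.mp h3).resolve_left h2
  have hCinj : ∀ w, S.C w = 0 → w = 0 := fun w hw => by
    rw [← S.hC w, hw, map_zero]
  -- a nonzero even vector
  obtain ⟨u, hu, hPu⟩ : ∃ u : V, u ≠ 0 ∧ S.P u = u := by
    by_cases h : v + S.P v = 0
    · have hPv : S.P v = -v := (neg_eq_of_add_eq_zero_right h).symm
      refine ⟨S.C v, fun h0 => hv (hCinj v h0), ?_⟩
      rw [S.hPC, hPv]; simp
    · exact ⟨_, h, by rw [map_add, S.hP, add_comm]⟩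
  let E : Submodule K V := LinearMap.eqLocus S.P LinearMap.id
  have hE : ∀ x, x ∈ E ↔ S.P x = x := fun x => Iff.rfl
  have hXE : ∀ x ∈ E, S.X.toLinearMap x ∈ E := fun x hx => by
    rw [hE] at hx ⊢
    simp [S.hPX, hx]
  have : Nontrivial E := ⟨⟨⟨u, hPu⟩, 0, fun h => hu (congrArg Subtype.val h)⟩⟩
  obtain ⟨z, hzev⟩ := Module.End.exists_eigenvalue (S.X.toLinearMap.restrict hXE)
  obtain ⟨⟨w, hwE⟩, hw⟩ := hzev.exists_hasEigenvector
  have hw0 : w ≠ 0 := fun h => hw.2 (Subtype.ext h)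
  have hXw : S.X w = z • w := congrArg Subtype.val hw.apply_eq_smul
  have hPw : S.P w = w := hwE
  have hz : z ≠ 0 := by
    rintro rfl
    rw [zero_smul] at hXw
    exact hw0 (by simpa using hXw)
  have hXsw : S.X.symm w = z⁻¹ • w := by
    rw [LinearEquiv.symm_apply_eq, map_smul, hXw, smul_smul, inv_mul_cancel₀ hz, one_smul]
  have hXC : S.X (S.C w) = z⁻¹ • S.C w := by rw [S.hXC, hXsw, map_smul]
  have hXsC : S.X.symm (S.C w) = z • S.C w := by
    rw [LinearEquiv.symm_apply_eq, map_smul, hXC, smul_smul, mul_inv_cancel₀ hz, one_smul]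
  have hPC : S.P (S.C w) = -S.C w := by rw [S.hPC, hPw]
  let g : K × K →ₗ[K] V :=
    (LinearMap.toSpanSingleton K V w).coprod (LinearMap.toSpanSingleton K V (S.C w))
  have hg : ∀ p, g p = p.1 • w + p.2 • S.C w := fun p => by simp [g]
  have gX : ∀ p, g ((Umod K z hz).X p) = S.X (g p) := fun p => by
    simp only [hg, Umod_X, map_add, map_smul, hXw, hXC, smul_smul]
    simp only [mul_comm]
  have gC : ∀ p, g ((Umod K z hz).C p) = S.C (g p) := fun p => by
    simp only [hg, Umod_C, map_add, map_smul, S.hC]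
    rw [add_comm]
  have gP : ∀ p, g ((Umod K z hz).P p) = S.P (g p) := fun p => by
    simp only [hg, Umod_P, map_add, map_smul, hPw, hPC, smul_neg, neg_smul]
  have hinj : Function.Injective g := by
    rw [injective_iff_map_eq_zero]
    intro p hp
    have hp' := gP p
    rw [hp, map_zero] at hp'
    simp only [hg, Umod_P] at hp hp'
    have h1 : p.1 • w = 0 := hself _ (by
      have e1 := eq_neg_of_add_eq_zero_left hp
      have e2 := eq_neg_of_add_eq_zero_left hp'
      rw [neg_smul, neg_neg] at e2
      rw [← e2] at e1
      exact e1)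
    rw [h1, zero_add] at hp
    have hC0 : S.C w ≠ 0 := fun h => hw0 (hCinj w h)
    exact Prod.ext ((smul_eq_zero.mp h1).resolve_right hw0)
      ((smul_eq_zero.mp hp).resolve_right hC0)
  have hsurj : Function.Surjective g := by
    rw [← LinearMap.range_eq_top]
    refine (hsub (LinearMap.range g) ?_ ?_ ?_ ?_).resolve_left ?_
    · rintro _ ⟨p, rfl⟩; exact ⟨_, gX p⟩
    · rintro _ ⟨p, rfl⟩
      refine ⟨(Umod K z hz).X.symm p, ?_⟩
      rw [LinearEquiv.eq_symm_apply, ← gX, LinearEquiv.apply_symm_apply]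
    · rintro _ ⟨p, rfl⟩; exact ⟨_, gC p⟩
    · rintro _ ⟨p, rfl⟩; exact ⟨_, gP p⟩
    · intro h
      have : w ∈ LinearMap.range g := ⟨(1, 0), by simp [hg]⟩
      rw [h] at this
      exact hw0 (by simpa using this)
  let G := LinearEquiv.ofBijective g ⟨hinj, hsurj⟩
  have hG : ∀ p, G p = g p := fun _ => rfl
  refine ⟨z, hz, G.symm, Or.inl ⟨?_, ?_, ?_⟩⟩
  · intro x
    rw [LinearEquiv.symm_apply_eq, hG, gX, ← hG, LinearEquiv.apply_symm_apply]
  · intro x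
    rw [LinearEquiv.symm_apply_eq, hG, gC, ← hG, LinearEquiv.apply_symm_apply]
  · intro x
    rw [LinearEquiv.symm_apply_eq, hG, gP, ← hG, LinearEquiv.apply_symm_apply]

theorem stmt13 (K : Type) [Field K] [IsAlgClosed K] (hchar : ringChar K ≠ 2) :
    (∀ (z z' : K) (hz : z ≠ 0) (hz' : z' ≠ 0),
        A1Iso (Umod K z hz) (Umod K z' hz') ↔ (z' = z ∨ z' = z⁻¹)) ∧
    (∀ (V : Type) [AddCommGroup V] [Module K V] (S : A1Str K V),
        FiniteDimensional K V → A1Irred S →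
        ∃ (z : K) (hz : z ≠ 0), A1Iso S (Umod K z hz)) ∧
    (∀ (z : K) (hz : z ≠ 0),
        (z ^ 2 = 1 → Module.finrank K (superEnd (Umod K z hz)) = 2) ∧
        (z ^ 2 ≠ 1 → Module.finrank K (superEnd (Umod K z hz)) = 1)) := by
  have h2 : (2 : K) ≠ 0 := Ring.two_ne_zero hchar
  exact ⟨fun z z' hz hz' => iso_part h2 z z' hz hz',
    fun V _ _ S hfd hirr => irred_part h2 V S hfd hirr,
    fun z hz => type_part h2 z hz⟩
end
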